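/- Let E be a connected directed graph, Γ a group, c : E¹ → Γ a function, and v a vertex of E. Then the skew product graph E ×_c Γ is connected if and only if the local voltage group Γ_v(c) equals Γ. -/

import Mathlib

/-- A directed graph with vertex type `V` and edge type `E`. -/
structure DiGraph (V : Type) (E : Type) where
  s : E → V
  r : E → V

namespace DiGraph

variable {V E : Type} (G : DiGraph V E)

/-- A dart is an edge traversed forwards (`inl`) or backwards (`inr`). -/
def dartS : E ⊕ E → V := fun d => match d with | .inl e => G.s e | .inr e => G.r e

def dartR : E ⊕ E → V := fun d => match d with | .inl e => G.r e | .inr e => G.s e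

/-- `l` is a walk (as a list of darts). -/
def IsWalk (l : List (E ⊕ E)) : Prop := l.Chain' (fun d d' => G.dartR d = G.dartS d')

/-- `l` is a walk from `v` to `w`. -/
def IsWalkFrom (v w : V) (l : List (E ⊕ E)) : Prop :=
  G.IsWalk l ∧ (∀ d ∈ l.head?, G.dartS d = v) ∧ (∀ d ∈ l.getLast?, G.dartR d = w) ∧
    (l = [] → v = w)

/-- `l` is a (directed) path, as a list of edges. -/
def IsPath (l : List E) : Prop := l.Chain' (fun e e' => G.r e = G.s e')

/-- `l` is a path from `v` to `w` (vertices count as paths of length `0`). -/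
def IsPathFrom (v w : V) (l : List E) : Prop :=
  G.IsPath l ∧ (∀ e ∈ l.head?, G.s e = v) ∧ (∀ e ∈ l.getLast?, G.r e = w) ∧
    (l = [] → v = w)

/-- An infinite path. -/
def IsInfPath (x : ℕ → E) : Prop := ∀ i, G.r (x i) = G.s (x (i + 1))

/-- The graph is cofinal. -/
def Cofinal : Prop :=
  ∀ x : ℕ → E, G.IsInfPath x → ∀ v : V, ∃ n : ℕ, ∃ l : List E, G.IsPathFrom v (G.r (x n)) l

/-- The graph is strongly connected. -/
def StronglyConnected : Prop :=
  ∀ v w : V, ∃ l : List E, l ≠ [] ∧ G.IsPathFrom v w l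

/-- The set of lengths of loops based at `v`. -/
def loopLengths (v : V) : Set ℕ :=
  {n | 0 < n ∧ ∃ l : List E, l.length = n ∧ G.IsPathFrom v v l}

/-- Two vertices are joined by a walk. -/
def Reachable (v w : V) : Prop := ∃ l : List (E ⊕ E), G.IsWalkFrom v w l

/-- The graph is connected. -/
def Connected : Prop := ∀ v w : V, G.Reachable v w

end DiGraph

/-- `d` is the greatest common divisor of the set `S` of natural numbers. -/
def IsGcdOf (d : ℕ) (S : Set ℕ) : Prop :=
  (∀ n ∈ S, d ∣ n) ∧ ∀ k : ℕ, (∀ n ∈ S, k ∣ n) → k ∣ d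

/-- The skew product graph `E ×_c Γ`. -/
def DiGraph.skew {V E : Type} (G : DiGraph V E) (Γ : Type) [Group Γ] (c : E → Γ) :
    DiGraph (V × Γ) (E × Γ) where
  s := fun x => (G.s x.1, x.2)
  r := fun x => (G.r x.1, x.2 * c x.1)

/-- The label of a walk: the product of the labels of its darts. -/
def cWalk {E Γ : Type} [Group Γ] (c : E → Γ) (l : List (E ⊕ E)) : Γ :=
  (l.map (fun d => match d with | .inl e => c e | .inr e => (c e)⁻¹)).prod

/-- The local voltage group of `c` based at `v`, as a set. -/
def voltage {V E : Type} (G : DiGraph V E) {Γ : Type} [Group Γ] (c : E → Γ) (v : V) : Set Γ :=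
  {g | ∃ l : List (E ⊕ E), G.IsWalkFrom v v l ∧ cWalk c l = g}

namespace DiGraph

section Walks

variable {V E : Type} (G : DiGraph V E)

theorem isWalk_iff_isChain {l : List (E ⊕ E)} :
    G.IsWalk l ↔ l.IsChain (fun d d' => G.dartR d = G.dartS d') :=
  Iff.rfl

theorem isWalkFrom_nil {v w : V} : G.IsWalkFrom v w [] ↔ v = w := by
  simp [IsWalkFrom, isWalk_iff_isChain]

theorem isWalkFrom_cons {v w : V} {d : E ⊕ E} {l : List (E ⊕ E)} :
    G.IsWalkFrom v w (d :: l) ↔ G.dartS d = v ∧ G.IsWalkFrom (G.dartR d) w l := by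
  cases l with
  | nil => simp [IsWalkFrom, isWalk_iff_isChain]
  | cons a l =>
    simp only [IsWalkFrom, isWalk_iff_isChain, List.isChain_cons_cons, List.head?_cons,
      List.getLast?_cons_cons, Option.mem_def, Option.some.injEq, forall_eq', reduceCtorEq,
      false_implies, and_true]
    grind

theorem IsWalkFrom.append {u v w : V} {l l' : List (E ⊕ E)}
    (h : G.IsWalkFrom u v l) (h' : G.IsWalkFrom v w l') : G.IsWalkFrom u w (l ++ l') := by
  induction l generalizing u with
  | nil => rwa [G.isWalkFrom_nil.1 h]
  | cons d l ih =>
    obtain ⟨hs, hl⟩ := G.isWalkFrom_cons.1 h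
    exact G.isWalkFrom_cons.2 ⟨hs, ih hl⟩

end Walks

end DiGraph

section Labels

variable {E Γ : Type} [Group Γ] (c : E → Γ)

theorem cWalk_nil : cWalk c [] = 1 := rfl

theorem cWalk_cons_inl (e : E) (l : List (E ⊕ E)) :
    cWalk c (.inl e :: l) = c e * cWalk c l := by
  simp [cWalk]

theorem cWalk_cons_inr (e : E) (l : List (E ⊕ E)) :
    cWalk c (.inr e :: l) = (c e)⁻¹ * cWalk c l := by
  simp [cWalk]

theorem cWalk_append (l l' : List (E ⊕ E)) :
    cWalk c (l ++ l') = cWalk c l * cWalk c l' := by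
  simp [cWalk]

end Labels

namespace DiGraph

section Skew

variable {V E : Type} (G : DiGraph V E) {Γ : Type} [Group Γ] (c : E → Γ)

/-- A walk in the base graph lifts to the skew product with any prescribed initial level. -/
theorem IsWalkFrom.skew_reachable {u w : V} {l : List (E ⊕ E)} (h : G.IsWalkFrom u w l)
    (g : Γ) : (G.skew Γ c).Reachable (u, g) (w, g * cWalk c l) := by
  induction l generalizing u g with
  | nil => exact ⟨[], (isWalkFrom_nil _).2 (by simp [G.isWalkFrom_nil.1 h, cWalk_nil])⟩
  | cons d l ih =>
    obtain ⟨rfl, hl⟩ := G.isWalkFrom_cons.1 h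
    cases d with
    | inl e =>
      obtain ⟨m, hm⟩ := ih hl (g * c e)
      rw [mul_assoc, ← cWalk_cons_inl] at hm
      exact ⟨.inl (e, g) :: m, (isWalkFrom_cons _).2 ⟨rfl, hm⟩⟩
    | inr e =>
      obtain ⟨m, hm⟩ := ih hl (g * (c e)⁻¹)
      rw [mul_assoc, ← cWalk_cons_inr] at hm
      exact ⟨.inr (e, g * (c e)⁻¹) :: m,
        (isWalkFrom_cons _).2 ⟨by simp [dartS, DiGraph.skew], hm⟩⟩

/-- A walk in the skew product projects to a walk whose label is the change of level. -/
theorem IsWalkFrom.exists_of_skew {x y : V × Γ} {m : List (E × Γ ⊕ E × Γ)}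
    (h : (G.skew Γ c).IsWalkFrom x y m) :
    ∃ l, G.IsWalkFrom x.1 y.1 l ∧ x.2 * cWalk c l = y.2 := by
  induction m generalizing x with
  | nil =>
    obtain rfl := (isWalkFrom_nil _).1 h
    exact ⟨[], G.isWalkFrom_nil.2 rfl, by simp [cWalk_nil]⟩
  | cons d m ih =>
    obtain ⟨rfl, hm⟩ := (isWalkFrom_cons _).1 h
    obtain ⟨l, hl, hc⟩ := ih hm
    rcases d with ⟨e, g⟩ | ⟨e, g⟩
    · refine ⟨.inl e :: l, G.isWalkFrom_cons.2 ⟨rfl, hl⟩, ?_⟩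
      rw [← hc, cWalk_cons_inl]
      simp [dartS, dartR, DiGraph.skew, mul_assoc]
    · refine ⟨.inr e :: l, G.isWalkFrom_cons.2 ⟨rfl, hl⟩, ?_⟩
      rw [← hc, cWalk_cons_inr]
      simp [dartS, dartR, DiGraph.skew, mul_assoc]

end Skew

end DiGraph

/-- The skew product `E ×_c Γ` of a connected graph is connected
iff the local voltage group `Γ_v(c)` is all of `Γ`. -/
theorem skew_connected_iff_voltage_full
    {V E : Type} (G : DiGraph V E) {Γ : Type} [Group Γ] (c : E → Γ)
    (hconn : G.Connected) (v : V) :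
    (G.skew Γ c).Connected ↔ voltage G c v = Set.univ := by
  refine ⟨fun h => Set.eq_univ_of_forall fun g => ?_, ?_⟩
  · obtain ⟨m, hm⟩ := h (v, 1) (v, g)
    obtain ⟨l, hl, hc⟩ := hm.exists_of_skew G c
    exact ⟨l, hl, by simpa using hc⟩
  · rintro h ⟨u, g⟩ ⟨w, k⟩
    obtain ⟨a, ha⟩ := hconn u v
    obtain ⟨b, hb⟩ := hconn v w
    obtain ⟨l, hl, hc⟩ : (cWalk c a)⁻¹ * g⁻¹ * k * (cWalk c b)⁻¹ ∈ voltage G c v :=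
      h ▸ Set.mem_univ _
    have hk := ((ha.append G hl).append G hb).skew_reachable G c g
    rw [cWalk_append, cWalk_append, hc] at hk
    simpa [mul_assoc] using hk
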